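/- arXiv:2012.13530 — 2 statements merged into one kernel-verified Lean document; each statement's English description precedes it below -/
import Mathlib

section
/- Let (μ_t)_{t∈[0,T]} be a subprobability solution to (NLFPK). Then the identity ∫φ dμ_t − ∫φ dμ₀ = ∫₀ᵗ∫ L_{s,μ_s}φ(x) dμ_s(x) ds holds for every φ ∈ C²_b(ℝ^d) (not only for compactly supported φ) and every t ∈ [0,T]. -/
open MeasureTheory Topology Filter

noncomputable section

/-- Euclidean space `ℝ^d`. -/
abbrev Rd (d : ℕ) := Fin d → ℝ

/-- The space of subprobability measures on `ℝ^d`. -/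
def SP (d : ℕ) : Type := {μ : Measure (Rd d) // μ Set.univ ≤ 1}

/-- The vague topology on `SP d`: the initial topology of the maps `μ ↦ ∫ g dμ` for
`g : ℝ^d → ℝ` continuous with compact support. -/
instance (d : ℕ) : TopologicalSpace (SP d) :=
  ⨅ g : {g : Rd d → ℝ // Continuous g ∧ HasCompactSupport g},
    TopologicalSpace.induced (fun μ : SP d => ∫ x, g.1 x ∂μ.1) inferInstance

instance (d : ℕ) : MeasurableSpace (SP d) := borel (SP d)
instance (d : ℕ) : BorelSpace (SP d) := ⟨rfl⟩

/-- First-order partial derivative `∂_i f`. -/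
def pd {n : ℕ} (f : (Fin n → ℝ) → ℝ) (i : Fin n) (x : Fin n → ℝ) : ℝ :=
  fderiv ℝ f x (Pi.single i 1)

/-- Second-order partial derivative `∂²_{ij} f`. -/
def pd2 {n : ℕ} (f : (Fin n → ℝ) → ℝ) (i j : Fin n) (x : Fin n → ℝ) : ℝ :=
  fderiv ℝ (fun y => pd f j y) x (Pi.single i 1)

/-- Twice continuously differentiable with compact support. -/
def IsC2c {n : ℕ} (φ : (Fin n → ℝ) → ℝ) : Prop :=
  ContDiff ℝ 2 φ ∧ HasCompactSupport φ

/-- Twice continuously differentiable, bounded, with bounded first and second order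
partial derivatives. -/
def IsC2b {n : ℕ} (f : (Fin n → ℝ) → ℝ) : Prop :=
  ContDiff ℝ 2 f ∧ ∃ M : ℝ, ∀ x, |f x| ≤ M ∧ (∀ i, |pd f i x| ≤ M) ∧ ∀ i j, |pd2 f i j x| ≤ M

/-- Borel coefficients, with `a` symmetric and positive semidefinite (`S⁺_d`-valued). -/
def GoodCoeffs (d : ℕ) (a : ℝ → SP d → Rd d → Fin d → Fin d → ℝ)
    (b : ℝ → SP d → Rd d → Fin d → ℝ) : Prop :=
  (∀ i j, Measurable fun p : ℝ × SP d × Rd d => a p.1 p.2.1 p.2.2 i j) ∧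
  (∀ i, Measurable fun p : ℝ × SP d × Rd d => b p.1 p.2.1 p.2.2 i) ∧
  (∀ t μ x i j, a t μ x i j = a t μ x j i) ∧
  (∀ t μ x (v : Fin d → ℝ), 0 ≤ ∑ i, ∑ j, v i * a t μ x i j * v j)

/-- The Kolmogorov operator `L_{t,μ}φ = ∑ a_ij ∂²_ij φ + ∑ b_i ∂_i φ`. -/
def Lop {d : ℕ} (a : ℝ → SP d → Rd d → Fin d → Fin d → ℝ)
    (b : ℝ → SP d → Rd d → Fin d → ℝ) (t : ℝ) (μ : SP d) (φ : Rd d → ℝ) (x : Rd d) : ℝ :=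
  (∑ i, ∑ j, a t μ x i j * pd2 φ i j x) + ∑ i, b t μ x i * pd φ i x

/-- Global integrability condition for (NLFPK). -/
def NLFPKIntegrable (d : ℕ) (T : ℝ) (a : ℝ → SP d → Rd d → Fin d → Fin d → ℝ)
    (b : ℝ → SP d → Rd d → Fin d → ℝ) (μ : ℝ → SP d) : Prop :=
  ∀ i j, ∫⁻ t in Set.Ioc (0:ℝ) T,
      ∫⁻ x, ENNReal.ofReal (|a t (μ t) x i j| + |b t (μ t) x i|) ∂(μ t).1 < ⊤

/-- The weak form of the nonlinear FPK equation, tested against `φ` at time `t`. -/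
def NLFPKEq (d : ℕ) (a : ℝ → SP d → Rd d → Fin d → Fin d → ℝ)
    (b : ℝ → SP d → Rd d → Fin d → ℝ) (μ : ℝ → SP d) (φ : Rd d → ℝ) (t : ℝ) : Prop :=
  ∫ x, φ x ∂(μ t).1 - ∫ x, φ x ∂(μ 0).1 = ∫ s in (0:ℝ)..t, ∫ x, Lop a b s (μ s) φ x ∂(μ s).1

/-- Subprobability solution to (NLFPK): a vaguely continuous, globally integrable curve
in `SP` satisfying the weak equation for all test functions in `C²_c(ℝ^d)`. -/
def IsSubprobSolution (d : ℕ) (T : ℝ) (a : ℝ → SP d → Rd d → Fin d → Fin d → ℝ)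
    (b : ℝ → SP d → Rd d → Fin d → ℝ) (μ : ℝ → SP d) : Prop :=
  ContinuousOn μ (Set.Icc 0 T) ∧ NLFPKIntegrable d T a b μ ∧
  ∀ φ : Rd d → ℝ, IsC2c φ → ∀ t ∈ Set.Icc (0:ℝ) T, NLFPKEq d a b μ φ t

/-- Weak continuity (in duality with bounded continuous functions) of a curve in `SP`. -/
def WeaklyContinuousOn {d : ℕ} (μ : ℝ → SP d) (s : Set ℝ) : Prop :=
  ∀ f : Rd d → ℝ, Continuous f → (∃ M, ∀ x, |f x| ≤ M) →
    ContinuousOn (fun t => ∫ x, f x ∂(μ t).1) s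

/-- Probability solution to (NLFPK): a weakly continuous solution consisting of
probability measures. -/
def IsProbSolution (d : ℕ) (T : ℝ) (a : ℝ → SP d → Rd d → Fin d → Fin d → ℝ)
    (b : ℝ → SP d → Rd d → Fin d → ℝ) (μ : ℝ → SP d) : Prop :=
  IsSubprobSolution d T a b μ ∧ (∀ t ∈ Set.Icc (0:ℝ) T, (μ t).1 Set.univ = 1) ∧
  WeaklyContinuousOn μ (Set.Icc 0 T)

section PartialDerivatives

variable {d : ℕ} {f g : Rd d → ℝ}

lemma pd_mul {x : Rd d} (hf : DifferentiableAt ℝ f x) (hg : DifferentiableAt ℝ g x) (i : Fin d) :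
    pd (fun y => f y * g y) i x = f x * pd g i x + g x * pd f i x := by
  simp [pd, fderiv_fun_mul hf hg]

lemma contDiff_pd (hf : ContDiff ℝ 2 f) (i : Fin d) : ContDiff ℝ 1 (pd f i) := by
  have h : ContDiff ℝ 1 (fderiv ℝ f) := hf.fderiv_right (by norm_num)
  exact h.clm_apply contDiff_const

lemma continuous_pd (hf : ContDiff ℝ 2 f) (i : Fin d) : Continuous (pd f i) :=
  (contDiff_pd hf i).continuous

lemma continuous_pd2 (hf : ContDiff ℝ 2 f) (i j : Fin d) : Continuous (pd2 f i j) :=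
  ((contDiff_pd hf j).continuous_fderiv one_ne_zero).clm_apply continuous_const

lemma pd2_mul (hf : ContDiff ℝ 2 f) (hg : ContDiff ℝ 2 g) (i j : Fin d) (x : Rd d) :
    pd2 (fun y => f y * g y) i j x =
      f x * pd2 g i j x + pd g j x * pd f i x + (g x * pd2 f i j x + pd f j x * pd g i x) := by
  have hf' := hf.differentiable two_ne_zero
  have hg' := hg.differentiable two_ne_zero
  have hpf := (contDiff_pd hf j).differentiable one_ne_zero
  have hpg := (contDiff_pd hg j).differentiable one_ne_zero
  have h : (fun y => pd (fun z => f z * g z) j y) =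
      fun y => f y * pd g j y + g y * pd f j y := by
    funext y
    exact pd_mul (hf' y) (hg' y) j
  have e1 : pd2 (fun y => f y * g y) i j x = pd (fun y => f y * pd g j y) i x +
      pd (fun y => g y * pd f j y) i x := by
    simp only [pd2, h]
    rw [fderiv_fun_add ((hf' x).fun_mul (hpg x)) ((hg' x).fun_mul (hpf x))]
    rfl
  rw [e1, pd_mul (hf' x) (hpg x), pd_mul (hg' x) (hpf x)]
  rfl

lemma pd_comp_smul (c : ℝ) (i : Fin d) (x : Rd d) :
    pd (fun y => f (c • y)) i x = c * pd f i (c • x) := by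
  simp [pd, fderiv_comp_smul]

lemma pd2_comp_smul (hf : ContDiff ℝ 2 f) (c : ℝ) (i j : Fin d) (x : Rd d) :
    pd2 (fun y => f (c • y)) i j x = c * (c * pd2 f i j (c • x)) := by
  have h : (fun y => pd (fun z => f (c • z)) j y) = fun y => c * pd f j (c • y) := by
    funext y
    exact pd_comp_smul c j y
  have hd : DifferentiableAt ℝ (fun y => pd f j (c • y)) x :=
    (((contDiff_pd hf j).differentiable one_ne_zero).comp (differentiable_id.const_smul c)) x
  simp only [pd2, h]
  rw [fderiv_const_mul hd]
  simp [fderiv_comp_smul]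

lemma pd_congr {x : Rd d} (h : f =ᶠ[𝓝 x] g) (i : Fin d) : pd f i x = pd g i x := by
  simp only [pd, h.fderiv_eq]

lemma pd2_congr {x : Rd d} (h : f =ᶠ[𝓝 x] g) (i j : Fin d) : pd2 f i j x = pd2 g i j x := by
  have h' : (fun y => pd f j y) =ᶠ[𝓝 x] fun y => pd g j y := by
    filter_upwards [h.eventuallyEq_nhds] with y hy using pd_congr hy j
  simp only [pd2, h'.fderiv_eq]

lemma IsC2c.isC2b (hf : IsC2c f) : IsC2b f := by
  obtain ⟨hf, hs⟩ := hf
  have hs1 (i : Fin d) : HasCompactSupport (pd f i) := hs.fderiv_apply ℝ _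
  have hs2 (i j : Fin d) : HasCompactSupport (pd2 f i j) := (hs1 j).fderiv_apply ℝ _
  obtain ⟨M, hM⟩ := hs.exists_bound_of_continuous hf.continuous
  choose M1 hM1 using fun i => (hs1 i).exists_bound_of_continuous (continuous_pd hf i)
  choose M2 hM2 using fun i j => (hs2 i j).exists_bound_of_continuous (continuous_pd2 hf i j)
  refine ⟨hf, |M| + ∑ i, |M1 i| + ∑ i, ∑ j, |M2 i j|, fun x => ⟨?_, fun i => ?_, fun i j => ?_⟩⟩
  · have h1 : 0 ≤ ∑ i, |M1 i| := by positivity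
    have h2 : 0 ≤ ∑ i, ∑ j, |M2 i j| := by positivity
    have h3 := (hM x).trans (le_abs_self M)
    rw [Real.norm_eq_abs] at h3
    linarith
  · have h1 : |M1 i| ≤ ∑ i, |M1 i| :=
      Finset.single_le_sum (f := fun i => |M1 i|) (fun _ _ => abs_nonneg _) (Finset.mem_univ i)
    have h2 : 0 ≤ ∑ i, ∑ j, |M2 i j| := by positivity
    have h3 := (hM1 i x).trans (le_abs_self _)
    rw [Real.norm_eq_abs] at h3
    linarith [abs_nonneg M]
  · have h1 : 0 ≤ ∑ i, |M1 i| := by positivity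
    have h2 : |M2 i j| ≤ ∑ j, |M2 i j| :=
      Finset.single_le_sum (f := fun j => |M2 i j|) (fun _ _ => abs_nonneg _) (Finset.mem_univ j)
    have h2' : ∑ j, |M2 i j| ≤ ∑ i, ∑ j, |M2 i j| :=
      Finset.single_le_sum (f := fun i => ∑ j, |M2 i j|)
        (fun _ _ => Finset.sum_nonneg fun _ _ => abs_nonneg _) (Finset.mem_univ i)
    have h3 := (hM2 i j x).trans (le_abs_self _)
    rw [Real.norm_eq_abs] at h3
    linarith [abs_nonneg M]

end PartialDerivatives

/-- Smooth cutoff functions exhausting `ℝ^d` with uniformly bounded derivatives up to order two. -/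
lemma exists_cutoff (d : ℕ) : ∃ (χ : ℕ → Rd d → ℝ) (C : ℝ), (∀ n, IsC2c (χ n)) ∧
    (∀ n x, |χ n x| ≤ 1) ∧ (∀ n x i, |pd (χ n) i x| ≤ C) ∧ (∀ n x i j, |pd2 (χ n) i j x| ≤ C) ∧
    ∀ x, ∀ᶠ n in atTop, χ n =ᶠ[𝓝 x] fun _ => 1 := by
  let β : ContDiffBump (0 : Rd d) := ⟨1, 2, one_pos, one_lt_two⟩
  have hβ : IsC2c (β : Rd d → ℝ) := ⟨β.contDiff, β.hasCompactSupport⟩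
  obtain ⟨-, M, hM⟩ := hβ.isC2b
  have hM0 : 0 ≤ M := (abs_nonneg _).trans (hM 0).1
  have hc0 (n : ℕ) : (0 : ℝ) < ((n : ℝ) + 1)⁻¹ := by positivity
  have hc1 (n : ℕ) : ((n : ℝ) + 1)⁻¹ ≤ 1 :=
    inv_le_one_of_one_le₀ (by linarith [n.cast_nonneg (α := ℝ)])
  have key (n : ℕ) (u : ℝ) (hu : |u| ≤ M) : |((n : ℝ) + 1)⁻¹ * u| ≤ M := by
    rw [abs_mul, abs_of_pos (hc0 n)]
    exact (mul_le_of_le_one_left (abs_nonneg u) (hc1 n)).trans hu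
  refine ⟨fun n x => β (((n : ℝ) + 1)⁻¹ • x), M, fun n => ⟨?_, ?_⟩, fun n x => ?_, fun n x i => ?_,
    fun n x i j => ?_, fun x => ?_⟩
  · exact hβ.1.comp (contDiff_id.const_smul _)
  · exact hβ.2.comp_homeomorph (Homeomorph.smulOfNeZero _ (hc0 n).ne')
  · rw [abs_of_nonneg β.nonneg]
    exact β.le_one
  · rw [pd_comp_smul]
    exact key n _ ((hM _).2.1 i)
  · rw [pd2_comp_smul hβ.1]
    exact key n _ (key n _ ((hM _).2.2 i j))
  · have hlim : Tendsto (fun n : ℕ => ((n : ℝ) + 1)⁻¹ • x) atTop (𝓝 0) := by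
      have := (tendsto_one_div_add_atTop_nhds_zero_nat (𝕜 := ℝ)).smul_const x
      simpa using this
    filter_upwards [hlim.eventually (Metric.ball_mem_nhds (0 : Rd d) one_pos)] with n hn
    have hcont : Continuous fun y : Rd d => ((n : ℝ) + 1)⁻¹ • y := continuous_const_smul _
    exact hcont.continuousAt.eventually (β.eventuallyEq_one_of_mem_ball hn)

section Vague

variable {d : ℕ}

instance (μ : SP d) : IsFiniteMeasure μ.1 := ⟨μ.2.trans_lt ENNReal.one_lt_top⟩

lemma measurable_integral_vague {g : Rd d → ℝ} (hg : Continuous g) (hs : HasCompactSupport g) :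
    Measurable fun μ : SP d => ∫ x, g x ∂μ.1 := by
  refine Continuous.measurable ?_
  exact continuous_iInf_dom
    (i := (⟨g, hg, hs⟩ : {g : Rd d → ℝ // Continuous g ∧ HasCompactSupport g}))
    continuous_induced_dom

lemma measurable_SP_val : Measurable (fun μ : SP d => μ.1) := by
  obtain ⟨χ, -, hχ, hχ1, -, -, hχlim⟩ := exists_cutoff d
  have closed (A : Set (Rd d)) (hA : IsClosed A) : Measurable fun μ : SP d => μ.1 A := by
    have hpos (n : ℕ) : (0 : ℝ) < 1 / ((n : ℝ) + 1) := by positivity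
    let θ (n : ℕ) (x : Rd d) : ℝ := thickenedIndicator (hpos n) A x
    have hθ (n : ℕ) : Continuous (θ n) :=
      NNReal.continuous_coe.comp (thickenedIndicator (hpos n) A).continuous
    have hθlim (x : Rd d) : Tendsto (fun n => θ n x) atTop (𝓝 (A.indicator 1 x)) := by
      have h := tendsto_pi_nhds.1 (thickenedIndicator_tendsto_indicator_closure hpos
        tendsto_one_div_add_atTop_nhds_zero_nat A) x
      rw [hA.closure_eq] at h
      have h' := (NNReal.continuous_coe.tendsto _).comp h
      have e : ((A.indicator (fun _ => 1) x : NNReal) : ℝ) = A.indicator 1 x := by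
        by_cases hx : x ∈ A <;> simp [hx]
      rwa [e] at h'
    have hmeas (n : ℕ) : Measurable fun μ : SP d => ∫ x, χ n x * θ n x ∂μ.1 :=
      measurable_integral_vague ((hχ n).1.continuous.mul (hθ n)) ((hχ n).2.mul_right)
    have hlim (μ : SP d) : Tendsto (fun n => ∫ x, χ n x * θ n x ∂μ.1) atTop (𝓝 (μ.1.real A)) := by
      rw [← integral_indicator_one hA.measurableSet]
      refine tendsto_integral_of_dominated_convergence (fun _ => 1)
        (fun n => ((hχ n).1.continuous.mul (hθ n)).aestronglyMeasurable) (integrable_const _)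
        (fun n => ae_of_all _ fun x => ?_) (ae_of_all _ fun x => ?_)
      · have h1 : |θ n x| ≤ 1 := by
          rw [abs_of_nonneg (NNReal.coe_nonneg _)]
          exact_mod_cast thickenedIndicator_le_one (hpos n) A x
        rw [Real.norm_eq_abs, abs_mul]
        exact mul_le_one₀ (hχ1 n x) (abs_nonneg _) h1
      · refine (hθlim x).congr' ?_
        filter_upwards [hχlim x] with n hn
        rw [hn.self_of_nhds, one_mul]
    have hreal : Measurable fun μ : SP d => μ.1.real A :=
      measurable_of_tendsto_metrizable hmeas (tendsto_pi_nhds.2 hlim)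
    simpa [ofReal_measureReal] using hreal.ennreal_ofReal
  refine Measurable.measure_of_isPiSystem (S := {s | IsClosed s}) ?_ isPiSystem_isClosed
    (fun A hA => closed A hA) (closed _ isClosed_univ)
  rw [BorelSpace.measurable_eq (α := Rd d), borel_eq_generateFrom_isClosed]

end Vague

section Operator

variable {d : ℕ} {a : ℝ → SP d → Rd d → Fin d → Fin d → ℝ} {b : ℝ → SP d → Rd d → Fin d → ℝ}

lemma abs_Lop_le {φ : Rd d → ℝ} {K : ℝ} {x : Rd d} (h1 : ∀ i, |pd φ i x| ≤ K)
    (h2 : ∀ i j, |pd2 φ i j x| ≤ K) (s : ℝ) (m : SP d) :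
    |Lop a b s m φ x| ≤ K * ∑ i, ∑ j, (|a s m x i j| + |b s m x i|) := by
  have hA : |∑ i, ∑ j, a s m x i j * pd2 φ i j x| ≤ ∑ i, ∑ j, K * |a s m x i j| := by
    refine (Finset.abs_sum_le_sum_abs _ _).trans (Finset.sum_le_sum fun i _ => ?_)
    refine (Finset.abs_sum_le_sum_abs _ _).trans (Finset.sum_le_sum fun j _ => ?_)
    rw [abs_mul, mul_comm]
    exact mul_le_mul_of_nonneg_right (h2 i j) (abs_nonneg _)
  have hB : |∑ i, b s m x i * pd φ i x| ≤ ∑ i, ∑ _j : Fin d, K * |b s m x i| := by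
    refine (Finset.abs_sum_le_sum_abs _ _).trans (Finset.sum_le_sum fun i _ => ?_)
    have hK : 0 ≤ K := (abs_nonneg _).trans (h1 i)
    refine le_trans ?_ (Finset.single_le_sum (f := fun _ : Fin d => K * |b s m x i|)
      (fun _ _ => by positivity) (Finset.mem_univ i))
    rw [abs_mul, mul_comm]
    exact mul_le_mul_of_nonneg_right (h1 i) (abs_nonneg _)
  refine (abs_add_le _ _).trans ((add_le_add hA hB).trans_eq ?_)
  simp only [Finset.mul_sum, mul_add, Finset.sum_add_distrib]

lemma Lop_congr {φ ψ : Rd d → ℝ} {x : Rd d} (h : φ =ᶠ[𝓝 x] ψ) (s : ℝ) (m : SP d) :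
    Lop a b s m φ x = Lop a b s m ψ x := by
  simp only [Lop, pd_congr h, pd2_congr h]

lemma measurable_Lop (hab : GoodCoeffs d a b) {μ : ℝ → SP d} (hμ : Measurable μ) {φ : Rd d → ℝ}
    (hφ : ContDiff ℝ 2 φ) : Measurable fun p : ℝ × Rd d => Lop a b p.1 (μ p.1) φ p.2 := by
  have hp : Measurable fun p : ℝ × Rd d => (p.1, μ p.1, p.2) := by fun_prop
  refine Measurable.add (Finset.measurable_sum _ fun i _ => Finset.measurable_sum _ fun j _ => ?_)
    (Finset.measurable_sum _ fun i _ => ?_)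
  · exact ((hab.1 i j).comp hp).mul ((continuous_pd2 hφ i j).measurable.comp measurable_snd)
  · exact ((hab.2.1 i).comp hp).mul ((continuous_pd hφ i).measurable.comp measurable_snd)

/-- The space-time measure `μ_s(dx) ds` on `(0,t] × ℝ^d`. -/
def spaceTime (μ : ℝ → SP d) (hμ : Measurable μ) (t : ℝ) : Measure (ℝ × Rd d) :=
  (volume.restrict (Set.Ioc 0 t)).compProd ⟨fun s => (μ s).1, measurable_SP_val.comp hμ⟩

lemma isFiniteKernel_SP (μ : ℝ → SP d) (hμ : Measurable μ) :
    ProbabilityTheory.IsFiniteKernel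
      (⟨fun s => (μ s).1, measurable_SP_val.comp hμ⟩ : ProbabilityTheory.Kernel ℝ (Rd d)) :=
  ⟨1, ENNReal.one_lt_top, fun s => (μ s).2⟩

lemma integral_spaceTime {μ : ℝ → SP d} (hμ : Measurable μ) {t : ℝ} {f : ℝ × Rd d → ℝ}
    (hf : Integrable f (spaceTime μ hμ t)) :
    ∫ p, f p ∂spaceTime μ hμ t = ∫ s in Set.Ioc 0 t, ∫ x, f (s, x) ∂(μ s).1 := by
  have := isFiniteKernel_SP μ hμ
  exact Measure.integral_compProd hf

lemma integrable_coeffs (hab : GoodCoeffs d a b) {μ : ℝ → SP d} (hμ : Measurable μ) {t T : ℝ}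
    (htT : t ≤ T) (hint : NLFPKIntegrable d T a b μ) :
    Integrable (fun p : ℝ × Rd d =>
      ∑ i, ∑ j, (|a p.1 (μ p.1) p.2 i j| + |b p.1 (μ p.1) p.2 i|)) (spaceTime μ hμ t) := by
  have := isFiniteKernel_SP μ hμ
  have hp : Measurable fun p : ℝ × Rd d => (p.1, μ p.1, p.2) := by fun_prop
  refine integrable_finsetSum _ fun i _ => integrable_finsetSum _ fun j _ => ?_
  have hm : Measurable fun p : ℝ × Rd d => |a p.1 (μ p.1) p.2 i j| + |b p.1 (μ p.1) p.2 i| :=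
    ((hab.1 i j).comp hp).abs.add ((hab.2.1 i).comp hp).abs
  refine ⟨hm.aestronglyMeasurable, ?_⟩
  rw [hasFiniteIntegral_iff_ofReal (ae_of_all _ fun p => by positivity), spaceTime,
    Measure.lintegral_compProd hm.ennreal_ofReal]
  exact (lintegral_mono_set (Set.Ioc_subset_Ioc_right htT)).trans_lt (hint i j)

/-- The weak equation extends from `C²_c` to `C²_b` along measurable integrable curves. -/
lemma NLFPKEq_of_measurable (hab : GoodCoeffs d a b) {μ : ℝ → SP d} (hμ : Measurable μ) {t T : ℝ}
    (ht : t ∈ Set.Icc 0 T) (hint : NLFPKIntegrable d T a b μ)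
    (heq : ∀ φ : Rd d → ℝ, IsC2c φ → NLFPKEq d a b μ φ t) {φ : Rd d → ℝ} (hφ : IsC2b φ) :
    NLFPKEq d a b μ φ t := by
  obtain ⟨hφ, M, hM⟩ := hφ
  obtain ⟨χ, C, hχ, hχ1, hχC, hχC2, hχlim⟩ := exists_cutoff d
  have hM0 : 0 ≤ M := (abs_nonneg _).trans (hM 0).1
  let φn (n : ℕ) (x : Rd d) : ℝ := φ x * χ n x
  have hφn (n : ℕ) : IsC2c (φn n) := ⟨hφ.mul (hχ n).1, (hχ n).2.mul_left⟩
  have hloc (x : Rd d) : ∀ᶠ n in atTop, φn n =ᶠ[𝓝 x] φ := by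
    filter_upwards [hχlim x] with n hn
    filter_upwards [hn] with y hy
    simp [φn, hy]
  have hpd (n : ℕ) (x : Rd d) (i : Fin d) : |pd (φn n) i x| ≤ M * C + M := by
    have e := pd_mul (hφ.differentiable two_ne_zero x) ((hχ n).1.differentiable two_ne_zero x) i
    rw [e]
    refine (abs_add_le _ _).trans ?_
    rw [abs_mul, abs_mul]
    refine add_le_add (mul_le_mul (hM x).1 (hχC n x i) (abs_nonneg _) hM0) ?_
    exact (mul_le_of_le_one_left (abs_nonneg _) (hχ1 n x)).trans ((hM x).2.1 i)
  have hpd2 (n : ℕ) (x : Rd d) (i j : Fin d) :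
      |pd2 (φn n) i j x| ≤ M * C + C * M + (M + M * C) := by
    have hC0 : 0 ≤ C := (abs_nonneg _).trans (hχC n x i)
    rw [pd2_mul hφ (hχ n).1]
    refine (abs_add_le _ _).trans (add_le_add ((abs_add_le _ _).trans (add_le_add ?_ ?_))
      ((abs_add_le _ _).trans (add_le_add ?_ ?_))) <;> rw [abs_mul]
    · exact mul_le_mul (hM x).1 (hχC2 n x i j) (abs_nonneg _) hM0
    · exact mul_le_mul (hχC n x j) ((hM x).2.1 i) (abs_nonneg _) hC0
    · exact (mul_le_of_le_one_left (abs_nonneg _) (hχ1 n x)).trans ((hM x).2.2 i j)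
    · exact mul_le_mul ((hM x).2.1 j) (hχC n x i) (abs_nonneg _) hM0
  let G (p : ℝ × Rd d) : ℝ := ∑ i, ∑ j, (|a p.1 (μ p.1) p.2 i j| + |b p.1 (μ p.1) p.2 i|)
  have hG : Integrable G (spaceTime μ hμ t) := integrable_coeffs hab hμ ht.2 hint
  have hLint {ψ : Rd d → ℝ} (hψ : IsC2b ψ) :
      Integrable (fun p : ℝ × Rd d => Lop a b p.1 (μ p.1) ψ p.2) (spaceTime μ hμ t) := by
    obtain ⟨hψ, K, hK⟩ := hψ
    refine (hG.const_mul K).mono' (measurable_Lop hab hμ hψ).aestronglyMeasurable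
      (ae_of_all _ fun p => ?_)
    exact abs_Lop_le (hK p.2).2.1 (hK p.2).2.2 p.1 (μ p.1)
  have hrhs {ψ : Rd d → ℝ} (hψ : IsC2b ψ) :
      ∫ s in (0 : ℝ)..t, ∫ x, Lop a b s (μ s) ψ x ∂(μ s).1 =
        ∫ p, Lop a b p.1 (μ p.1) ψ p.2 ∂spaceTime μ hμ t := by
    rw [integral_spaceTime hμ (hLint hψ), intervalIntegral.integral_of_le ht.1]
  have hlhs (m : SP d) : Tendsto (fun n => ∫ x, φn n x ∂m.1) atTop (𝓝 (∫ x, φ x ∂m.1)) := by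
    refine tendsto_integral_of_dominated_convergence (fun _ => M)
      (fun n => (hφn n).1.continuous.aestronglyMeasurable) (integrable_const _)
      (fun n => ae_of_all _ fun x => ?_) (ae_of_all _ fun x => ?_)
    · rw [Real.norm_eq_abs, abs_mul]
      exact (mul_le_of_le_one_right (abs_nonneg _) (hχ1 n x)).trans (hM x).1
    · refine tendsto_const_nhds.congr' ?_
      filter_upwards [hloc x] with n hn using hn.self_of_nhds.symm
  have hlim : Tendsto (fun n => ∫ p, Lop a b p.1 (μ p.1) (φn n) p.2 ∂spaceTime μ hμ t) atTop
      (𝓝 (∫ p, Lop a b p.1 (μ p.1) φ p.2 ∂spaceTime μ hμ t)) := by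
    let K : ℝ := max (M * C + M) (M * C + C * M + (M + M * C))
    refine tendsto_integral_of_dominated_convergence (fun p => K * G p)
      (fun n => (measurable_Lop hab hμ (hφn n).1).aestronglyMeasurable) (hG.const_mul K)
      (fun n => ae_of_all _ fun p => ?_) (ae_of_all _ fun p => ?_)
    · exact abs_Lop_le (fun i => (hpd n p.2 i).trans (le_max_left _ _))
        (fun i j => (hpd2 n p.2 i j).trans (le_max_right _ _)) p.1 (μ p.1)
    · refine tendsto_const_nhds.congr' ?_
      filter_upwards [hloc p.2] with n hn using (Lop_congr hn p.1 (μ p.1)).symm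
  rw [NLFPKEq, hrhs ⟨hφ, M, hM⟩]
  refine tendsto_nhds_unique ((hlhs (μ t)).sub (hlhs (μ 0))) (hlim.congr fun n => ?_)
  rw [← hrhs (hφn n).isC2b]
  exact (heq _ (hφn n)).symm

lemma NLFPKEq_congr {μ ν : ℝ → SP d} {t T : ℝ} (ht : t ∈ Set.Icc 0 T)
    (h : Set.EqOn μ ν (Set.Icc 0 T)) (φ : Rd d → ℝ) :
    NLFPKEq d a b μ φ t ↔ NLFPKEq d a b ν φ t := by
  have hint : ∫ s in (0 : ℝ)..t, ∫ x, Lop a b s (μ s) φ x ∂(μ s).1 =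
      ∫ s in (0 : ℝ)..t, ∫ x, Lop a b s (ν s) φ x ∂(ν s).1 := by
    refine intervalIntegral.integral_congr fun s hs => ?_
    rw [Set.uIcc_of_le ht.1] at hs
    simp only [h ⟨hs.1, hs.2.trans ht.2⟩]
  rw [NLFPKEq, NLFPKEq, hint, h ht, h ⟨le_rfl, ht.1.trans ht.2⟩]

lemma NLFPKIntegrable.congr {μ ν : ℝ → SP d} {T : ℝ} (h : Set.EqOn μ ν (Set.Icc 0 T))
    (hint : NLFPKIntegrable d T a b μ) : NLFPKIntegrable d T a b ν := by
  intro i j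
  refine lt_of_eq_of_lt (setLIntegral_congr_fun measurableSet_Ioc fun s hs => ?_) (hint i j)
  simp only [h (Set.Ioc_subset_Icc_self hs)]

end Operator

/-- Remark 2.2(ii): for a subprobability solution to (NLFPK), the weak
equation holds for every test function in `C²_b(ℝ^d)`, not only compactly supported ones. -/
theorem subprobSolution_eq_for_C2b (d : ℕ) (T : ℝ) (hT : 0 < T)
    (a : ℝ → SP d → Rd d → Fin d → Fin d → ℝ) (b : ℝ → SP d → Rd d → Fin d → ℝ)
    (hab : GoodCoeffs d a b) (μ : ℝ → SP d)
    (hμ : IsSubprobSolution d T a b μ) :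
    ∀ φ : Rd d → ℝ, IsC2b φ → ∀ t ∈ Set.Icc (0:ℝ) T, NLFPKEq d a b μ φ t := by
  classical
  obtain ⟨hcont, hint, heq⟩ := hμ
  intro φ hφ t ht
  let ν : ℝ → SP d := (Set.Icc 0 T).piecewise μ fun _ => μ 0
  have hν : Measurable ν :=
    hcont.measurable_piecewise continuousOn_const measurableSet_Icc
  have hμν : Set.EqOn μ ν (Set.Icc 0 T) := fun s hs => (Set.piecewise_eq_of_mem _ _ _ hs).symm
  rw [NLFPKEq_congr ht hμν]
  exact NLFPKEq_of_measurable hab hν ht (hint.congr hμν)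
    (fun ψ hψ => (NLFPKEq_congr ht hμν ψ).1 (heq ψ hψ t ht)) hφ
end
end

section
/- The map J : C([0,T],SP) → C([0,T],ℝ^∞), J((μ_t)_{t≤T}) := (G(μ_t))_{t≤T}, is well defined (images are continuous ℝ^∞-valued paths), measurable and injective; its range C_TG(SP) := {γ ∈ C([0,T],ℝ^∞) : γ_t ∈ G(SP) for all t} is a measurable subset of C([0,T],ℝ^∞); and the inverse map J⁻¹ : C_TG(SP) → C([0,T],SP) is measurable with respect to the trace σ-algebra on C_TG(SP). -/
open MeasureTheory Topology Filter

noncomputable section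

/-- `φ` and `ψ` are uniformly `ε`-close, together with their first and second order
partial derivatives (closeness in the `C²_b` norm). -/
def C2Close {n : ℕ} (φ ψ : (Fin n → ℝ) → ℝ) (ε : ℝ) : Prop :=
  (∀ x, |φ x - ψ x| ≤ ε) ∧ (∀ i x, |pd φ i x - pd ψ i x| ≤ ε) ∧
  ∀ i j x, |pd2 φ i j x - pd2 ψ i j x| ≤ ε

/-- A countable family `g i ∈ C²_c(ℝ^d) \ {0}` which is dense in `C²_c(ℝ^d)` with respect
to the `C²_b` norm. -/
def GFamily (d : ℕ) (g : ℕ → Rd d → ℝ) : Prop :=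
  (∀ i, IsC2c (g i)) ∧ (∀ i, g i ≠ 0) ∧
  ∀ φ : Rd d → ℝ, IsC2c φ → ∀ ε : ℝ, 0 < ε → ∃ i, C2Close (g i) φ ε

/-- The global chart `G : SP → ℝ^∞`, `G(μ) = (μ(g_i))_i`. -/
def Gmap {d : ℕ} (g : ℕ → Rd d → ℝ) (μ : SP d) : ℕ → ℝ := fun i => ∫ x, g i x ∂μ.1

/-- Vaguely continuous paths `[0,T] → SP`. -/
def PathSP (d : ℕ) (T : ℝ) := {γ : Set.Icc (0:ℝ) T → SP d // Continuous γ}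

/-- The σ-algebra on path space generated by the point evaluations `e_t`. -/
instance (d : ℕ) (T : ℝ) : MeasurableSpace (PathSP d T) :=
  ⨆ t : Set.Icc (0:ℝ) T, MeasurableSpace.comap (fun γ : PathSP d T => γ.1 t) inferInstance

/-- Extension of a path on `[0,T]` to all of `ℝ` (by the zero measure outside `[0,T]`). -/
def extendPath {d : ℕ} {T : ℝ} (γ : Set.Icc (0:ℝ) T → SP d) : ℝ → SP d :=
  fun t => if h : t ∈ Set.Icc (0:ℝ) T then γ ⟨t, h⟩ else ⟨0, by simp⟩

/-- Continuous paths `[0,T] → ℝ^∞`. -/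
def PathR (T : ℝ) := {γ : Set.Icc (0:ℝ) T → (ℕ → ℝ) // Continuous γ}

/-- The σ-algebra on path space generated by the point evaluations `e_t^∞`. -/
instance (T : ℝ) : MeasurableSpace (PathR T) :=
  ⨆ t : Set.Icc (0:ℝ) T, MeasurableSpace.comap (fun γ : PathR T => γ.1 t) inferInstance

namespace SP

variable {d : ℕ}

instance (μ : SP d) : IsFiniteMeasure μ.1 := ⟨μ.2.trans_lt ENNReal.one_lt_top⟩

lemma measureReal_univ_le_one (μ : SP d) : μ.1.real Set.univ ≤ 1 :=
  ENNReal.toReal_le_of_le_ofReal zero_le_one (by simpa using μ.2)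

lemma abs_integral_le (μ : SP d) {f : Rd d → ℝ} {C : ℝ} (hf : ∀ x, |f x| ≤ C) :
    |∫ x, f x ∂μ.1| ≤ C := by
  have hC : 0 ≤ C := (abs_nonneg _).trans (hf 0)
  calc |∫ x, f x ∂μ.1| = ‖∫ x, f x ∂μ.1‖ := rfl
    _ ≤ C * μ.1.real Set.univ := norm_integral_le_of_norm_le_const (.of_forall hf)
    _ ≤ C := mul_le_of_le_one_right hC μ.measureReal_univ_le_one

lemma integrable (μ : SP d) {f : Rd d → ℝ} (hf : Continuous f) (hc : HasCompactSupport f) :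
    Integrable f μ.1 :=
  hf.integrable_of_hasCompactSupport hc

lemma abs_integral_sub_le (μ : SP d) {f h : Rd d → ℝ} {ε : ℝ}
    (hf : Continuous f) (hfc : HasCompactSupport f) (hh : Continuous h)
    (hhc : HasCompactSupport h) (hε : ∀ x, |f x - h x| ≤ ε) :
    |∫ x, f x ∂μ.1 - ∫ x, h x ∂μ.1| ≤ ε := by
  rw [← integral_sub (μ.integrable hf hfc) (μ.integrable hh hhc)]
  exact μ.abs_integral_le hε

lemma le_nhds_iff {F : Filter (SP d)} {μ : SP d} :
    F ≤ 𝓝 μ ↔ ∀ f : Rd d → ℝ, Continuous f → HasCompactSupport f →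
      Tendsto (fun ν : SP d => ∫ x, f x ∂ν.1) F (𝓝 (∫ x, f x ∂μ.1)) := by
  rw [show 𝓝 μ = _ from nhds_iInf]
  simp only [nhds_induced, le_iInf_iff, ← tendsto_iff_comap, Subtype.forall, and_imp]

lemma continuous_integral {f : Rd d → ℝ} (hf : Continuous f) (hc : HasCompactSupport f) :
    Continuous (fun μ : SP d => ∫ x, f x ∂μ.1) :=
  continuous_iff_continuousAt.2 fun _ => le_nhds_iff.1 le_rfl f hf hc

lemma ext_of_integral_eq {μ ν : SP d}
    (h : ∀ f : Rd d → ℝ, Continuous f → HasCompactSupport f →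
      ∫ x, f x ∂μ.1 = ∫ x, f x ∂ν.1) : μ = ν :=
  Subtype.ext <| Measure.ext_of_integral_eq_on_compactlySupported fun f =>
    h f f.continuous f.hasCompactSupport

open CompactlySupported in
/-- A positive linear functional of norm at most one on compactly supported functions is
represented by a subprobability measure. -/
lemma exists_integral_eq (Λ : C_c(Rd d, ℝ) →ₚ[ℝ] ℝ)
    (hΛ : ∀ f : C_c(Rd d, ℝ), (∀ x, |f x| ≤ 1) → Λ f ≤ 1) :
    ∃ μ : SP d, ∀ f : C_c(Rd d, ℝ), ∫ x, f x ∂μ.1 = Λ f := by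
  refine ⟨⟨RealRMK.rieszMeasure Λ, ?_⟩, fun f => RealRMK.integral_rieszMeasure Λ f⟩
  rw [isOpen_univ.measure_eq_iSup_isCompact]
  refine iSup₂_le fun K _ => iSup_le fun hK => ?_
  obtain ⟨f, hf1, hfc, -, hf⟩ :=
    exists_continuousMap_one_of_isCompact_subset_isOpen hK isOpen_univ K.subset_univ
  refine (RealRMK.rieszMeasure_le_of_eq_one Λ (f := ⟨f, hfc⟩) (fun x => (hf x).1) hK
    fun x hx => hf1 hx).trans ?_
  refine ENNReal.ofReal_le_one.2 (hΛ _ fun x => ?_)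
  exact (abs_of_nonneg (hf x).1).trans_le (hf x).2

open CompactlySupported in
instance : CompactSpace (SP d) := by
  refine ⟨isCompact_iff_ultrafilter_le_nhds.2 fun F _ => ?_⟩
  have key (f : C_c(Rd d, ℝ)) :
      ∃ a, Tendsto (fun ν : SP d => ∫ x, f x ∂ν.1) F (𝓝 a) := by
    obtain ⟨C, hC⟩ := f.continuous.bounded_above_of_compact_support f.hasCompactSupport
    obtain ⟨a, -, ha⟩ := (isCompact_Icc (a := -C) (b := C)).ultrafilter_le_nhds
      (F.map fun ν : SP d => ∫ x, f x ∂ν.1)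
      (tendsto_principal.2 (.of_forall fun ν => abs_le.1 (ν.abs_integral_le hC)))
    exact ⟨a, ha⟩
  choose L hL using key
  let Λ : C_c(Rd d, ℝ) →ₚ[ℝ] ℝ := .mk₀
    { toFun := L
      map_add' := fun f h => by
        refine tendsto_nhds_unique (hL (f + h)) (((hL f).add (hL h)).congr fun ν => ?_)
        exact (integral_add (ν.integrable f.continuous f.hasCompactSupport)
          (ν.integrable h.continuous h.hasCompactSupport)).symm
      map_smul' := fun c f => by
        refine tendsto_nhds_unique (hL (c • f)) (((hL f).const_mul c).congr fun ν => ?_)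
        exact (integral_const_mul c _).symm }
    (fun f hf => ge_of_tendsto' (hL f) fun ν => integral_nonneg hf)
  obtain ⟨μ, hμ⟩ := exists_integral_eq Λ fun f hf =>
    le_of_tendsto' (hL f) fun ν => (le_abs_self _).trans (ν.abs_integral_le hf)
  refine ⟨μ, Set.mem_univ _, le_nhds_iff.2 fun f hf hc => ?_⟩
  have h : ∫ x, f x ∂μ.1 = L ⟨⟨f, hf⟩, hc⟩ := hμ ⟨⟨f, hf⟩, hc⟩
  rw [h]
  exact hL ⟨⟨f, hf⟩, hc⟩

end SP

namespace GFamily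

variable {d : ℕ} {g : ℕ → Rd d → ℝ}

lemma continuous (hg : GFamily d g) (i : ℕ) : Continuous (g i) := (hg.1 i).1.continuous

lemma hasCompactSupport (hg : GFamily d g) (i : ℕ) : HasCompactSupport (g i) := (hg.1 i).2

/-- The family is uniformly dense in the continuous functions with compact support. -/
lemma exists_abs_sub_le (hg : GFamily d g) {f : Rd d → ℝ} (hf : Continuous f)
    (hc : HasCompactSupport f) {ε : ℝ} (hε : 0 < ε) : ∃ i, ∀ x, |g i x - f x| ≤ ε := by
  obtain ⟨φ, hφ, hφf, hφs⟩ := hf.exists_contDiff_approx 2 (ε := fun _ => ε / 2)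
    continuous_const fun _ => half_pos hε
  obtain ⟨i, hi, -⟩ := hg.2.2 φ ⟨mod_cast hφ, hc.mono hφs⟩ (ε / 2) (half_pos hε)
  refine ⟨i, fun x => (abs_sub_le _ (φ x) _).trans ?_⟩
  have h : |φ x - f x| < ε / 2 := hφf x
  linarith [hi x]

lemma continuous_Gmap (hg : GFamily d g) : Continuous (Gmap g) :=
  continuous_pi fun i => SP.continuous_integral (hg.continuous i) (hg.hasCompactSupport i)

lemma tendsto_integral (hg : GFamily d g) {F : Filter (SP d)} {μ : SP d}
    (h : Tendsto (Gmap g) F (𝓝 (Gmap g μ))) {f : Rd d → ℝ} (hf : Continuous f)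
    (hc : HasCompactSupport f) :
    Tendsto (fun ν : SP d => ∫ x, f x ∂ν.1) F (𝓝 (∫ x, f x ∂μ.1)) := by
  rw [Metric.tendsto_nhds]
  intro ε hε
  obtain ⟨i, hi⟩ := hg.exists_abs_sub_le hf hc (ε := ε / 3) (by positivity)
  have hclose (ν : SP d) : |Gmap g ν i - ∫ x, f x ∂ν.1| ≤ ε / 3 :=
    ν.abs_integral_sub_le (hg.continuous i) (hg.hasCompactSupport i) hf hc hi
  filter_upwards [Metric.tendsto_nhds.1 (tendsto_pi_nhds.1 h i) (ε / 3) (by positivity)]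
    with ν hν
  rw [Real.dist_eq, abs_lt] at hν ⊢
  have h1 := abs_le.1 (hclose ν)
  have h2 := abs_le.1 (hclose μ)
  constructor <;> linarith

lemma isInducing_Gmap (hg : GFamily d g) : IsInducing (Gmap g) := by
  refine isInducing_iff_nhds.2 fun μ => le_antisymm hg.continuous_Gmap.continuousAt.le_comap ?_
  exact SP.le_nhds_iff.2 fun f hf hc => hg.tendsto_integral tendsto_comap hf hc

lemma injective_Gmap (hg : GFamily d g) : Function.Injective (Gmap g) := fun μ _ h =>
  SP.ext_of_integral_eq fun _ hf hc => tendsto_nhds_unique (tendsto_pure_nhds _ μ)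
    (hg.tendsto_integral (F := pure μ) (h ▸ tendsto_pure_nhds _ _) hf hc)

lemma isClosed_range_Gmap (hg : GFamily d g) : IsClosed (Set.range (Gmap g)) :=
  (isCompact_range hg.continuous_Gmap).isClosed

lemma measurable_of_measurable_Gmap_comp (hg : GFamily d g) {α : Type*} [MeasurableSpace α]
    {f : α → SP d} (hf : Measurable fun a => Gmap g (f a)) : Measurable f := by
  have h : (inferInstance : MeasurableSpace (SP d)) =
      MeasurableSpace.comap (Gmap g) MeasurableSpace.pi := by
    rw [BorelSpace.measurable_eq (α := SP d), hg.isInducing_Gmap.eq_induced, borel_comap,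
      ← BorelSpace.measurable_eq]
  rintro s hs
  rw [show MeasurableSet s ↔ MeasurableSet[MeasurableSpace.comap (Gmap g) MeasurableSpace.pi] s
    from by rw [← h]] at hs
  obtain ⟨t, ht, rfl⟩ := hs
  exact hf ht

end GFamily

lemma PathSP.measurable_iff {d : ℕ} {T : ℝ} {α : Type*} [MeasurableSpace α]
    {f : α → PathSP d T} : Measurable f ↔ ∀ t, Measurable fun a => (f a).1 t := by
  simp only [measurable_iff_comap_le, MeasurableSpace.comap_iSup, iSup_le_iff,
    MeasurableSpace.comap_comp, instMeasurableSpacePathSP, Function.comp_def]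

lemma PathR.measurable_iff {T : ℝ} {α : Type*} [MeasurableSpace α]
    {f : α → PathR T} : Measurable f ↔ ∀ t, Measurable fun a => (f a).1 t := by
  simp only [measurable_iff_comap_le, MeasurableSpace.comap_iSup, iSup_le_iff,
    MeasurableSpace.comap_comp, instMeasurableSpacePathR, Function.comp_def]

/-- The paths staying in a closed set form a measurable set. -/
lemma PathR.measurableSet_forall_mem {T : ℝ} {S : Set (ℕ → ℝ)} (hS : IsClosed S) :
    MeasurableSet {γ : PathR T | ∀ t, γ.1 t ∈ S} := by
  obtain ⟨D, hDc, hD⟩ := TopologicalSpace.exists_countable_dense (Set.Icc (0:ℝ) T)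
  have h : {γ : PathR T | ∀ t, γ.1 t ∈ S} = ⋂ t ∈ D, {γ : PathR T | γ.1 t ∈ S} := by
    ext γ
    simp only [Set.mem_ofPred_eq, Set.mem_iInter]
    refine ⟨fun h t _ => h t, fun h t => ?_⟩
    exact (hS.preimage γ.2).closure_subset_iff.2 h (hD t)
  rw [h]
  exact .biInter hDc fun t _ => PathR.measurable_iff.1 measurable_id t hS.measurableSet

/-- Lemma 3.3(ii): the map `J : C([0,T],SP) → C([0,T],ℝ^∞)`,
`J((μ_t)_t) = (G(μ_t))_t`, is well defined, measurable and injective, its range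
`C_T G(SP)` is measurable, and `J⁻¹` is measurable on it. -/
theorem pathLift_J_measurable (d : ℕ) (T : ℝ) (hT : 0 < T)
    (g : ℕ → Rd d → ℝ) (hg : GFamily d g) :
    ∃ J : PathSP d T → PathR T,
      (∀ (γ : PathSP d T) (t : Set.Icc (0:ℝ) T), (J γ).1 t = Gmap g (γ.1 t)) ∧
      Measurable J ∧ Function.Injective J ∧
      MeasurableSet {γ : PathR T | ∀ t, γ.1 t ∈ Set.range (Gmap g)} ∧
      ∃ Jinv : {γ : PathR T // ∀ t, γ.1 t ∈ Set.range (Gmap g)} → PathSP d T,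
        Measurable Jinv ∧
        ∀ (γ : PathSP d T) (h : ∀ t, (J γ).1 t ∈ Set.range (Gmap g)), Jinv ⟨J γ, h⟩ = γ := by
  have hinj := hg.injective_Gmap
  refine ⟨fun γ => ⟨fun t => Gmap g (γ.1 t), hg.continuous_Gmap.comp γ.2⟩, fun _ _ => rfl,
    ?_, ?_, PathR.measurableSet_forall_mem hg.isClosed_range_Gmap, ?_⟩
  · exact PathR.measurable_iff.2 fun t => hg.continuous_Gmap.measurable.comp
      (PathSP.measurable_iff.1 measurable_id t)
  · intro γ η h
    exact Subtype.ext <| funext fun t => hinj <| congrFun (congrArg Subtype.val h) t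
  · choose K hK using
      fun (γ : {γ : PathR T // ∀ t, γ.1 t ∈ Set.range (Gmap g)}) t => γ.2 t
    have hKc (γ) : Continuous (K γ) := by
      refine hg.isInducing_Gmap.continuous_iff.2 ?_
      simpa only [Function.comp_def, hK] using γ.1.2
    refine ⟨fun γ => ⟨K γ, hKc γ⟩, PathSP.measurable_iff.2 fun t => ?_, fun γ h => ?_⟩
    · refine hg.measurable_of_measurable_Gmap_comp ?_
      simpa only [hK] using PathR.measurable_iff.1 measurable_subtype_coe t
    · exact Subtype.ext <| funext fun t => hinj (hK ⟨_, h⟩ t)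
end
end
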